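/- Let N ≥ 4 be an integer, let p₁, …, p_m be distinct partitions of [k], let α ∈ ℂ^m, and suppose ξ = ∑_{i=1}^m α_i ξ_{p_i} is nonzero. Suppose for some index j there exists a crossing unique to p_j, i.e. κ ∈ cr(p_j) ∖ ⋃_{i ≠ j} cr(p_i). Then α_j = 0 or ⟨NC, ξ⟩ = P (equality of families meaning equality of each subspace C(k',ℓ')). -/

import Mathlib

open scoped Classical

/-- The block relation of a finite partition of `Fin n` (partition of `[n]`):
`x ∼_p y` iff `x` and `y` lie in the same block of `p`. -/
def PartRel {n : ℕ} (p : Finpartition (Finset.univ : Finset (Fin n))) (x y : Fin n) : Prop :=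
  ∃ B ∈ p.parts, x ∈ B ∧ y ∈ B

/-- `κ` is a crossing of the relation `r`: `κ = {a,b,c,d}` with `a < b < c < d`,
`r a c`, `r b d`, and `¬ r a b`. -/
def IsCross {n : ℕ} (r : Fin n → Fin n → Prop) (κ : Finset (Fin n)) : Prop :=
  ∃ a b c d : Fin n, a < b ∧ b < c ∧ c < d ∧ κ = {a, b, c, d} ∧ r a c ∧ r b d ∧ ¬ r a b

/-- `cr p`: the set of crossings of the partition `p`. -/
def cr {n : ℕ} (p : Finpartition (Finset.univ : Finset (Fin n))) : Set (Finset (Fin n)) :=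
  {κ | IsCross (PartRel p) κ}


/-- `crossers p` (`χ(p)`): the union of all crossings of `p`. -/
def crossers {n : ℕ} (p : Finpartition (Finset.univ : Finset (Fin n))) : Set (Fin n) :=
  {x | ∃ κ ∈ cr p, x ∈ κ}

/-- The vector `ξ_p ∈ (ℂ^N)^{⊗k}`, identified with `(Fin k → Fin N) → ℂ`:
its coordinate at `i` is `1` if `i` is constant on every block of `p`, else `0`. -/
noncomputable def xi (N : ℕ) {k : ℕ} (p : Finpartition (Finset.univ : Finset (Fin k))) :
    (Fin k → Fin N) → ℂ :=
  fun i => if ∀ x y, PartRel p x y → i x = i y then 1 else 0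

/-- The span of the noncrossing-partition vectors `ξ_p`, `p ∈ NC(k)`. -/
noncomputable def ncSpan (N k : ℕ) : Submodule ℂ ((Fin k → Fin N) → ℂ) :=
  Submodule.span ℂ
    {v | ∃ p : Finpartition (Finset.univ : Finset (Fin k)), cr p = ∅ ∧ v = xi N p}

/-- The span of the crossing-partition vectors `ξ_p`, `p ∈ CR(k)`. -/
noncomputable def crSpan (N k : ℕ) : Submodule ℂ ((Fin k → Fin N) → ℂ) :=
  Submodule.span ℂ
    {v | ∃ p : Finpartition (Finset.univ : Finset (Fin k)), (cr p).Nonempty ∧ v = xi N p}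

/-- The span of all partition vectors `ξ_p`, `p ∈ P(k)`. -/
noncomputable def allSpan (N k : ℕ) : Submodule ℂ ((Fin k → Fin N) → ℂ) :=
  Submodule.span ℂ
    {v | ∃ p : Finpartition (Finset.univ : Finset (Fin k)), v = xi N p}

/-- Linear maps `(ℂ^N)^{⊗k} → (ℂ^N)^{⊗ℓ}`, as matrices with rows indexed by
lower index tuples and columns by upper index tuples. -/
abbrev Mat (N k ℓ : ℕ) := Matrix (Fin ℓ → Fin N) (Fin k → Fin N) ℂ

/-- The tensor product of two such linear maps. -/
def tensorMat {N k ℓ k' ℓ' : ℕ} (S : Mat N k ℓ) (T : Mat N k' ℓ') :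
    Mat N (k + k') (ℓ + ℓ') :=
  fun i j =>
    S (fun a => i (Fin.castAdd ℓ' a)) (fun b => j (Fin.castAdd k' b)) *
      T (fun a => i (Fin.natAdd ℓ a)) (fun b => j (Fin.natAdd k b))

/-- The cup: the map `(ℂ^N)^{⊗2} → ℂ` sending `e_i ⊗ e_j` to `δ_{ij}`. -/
def cupMat (N : ℕ) : Mat N 2 0 := fun _ j => if j 0 = j 1 then 1 else 0

/-- A Tannaka–Krein dual at parameter `N`: a family of subspaces
`C k ℓ ⊆ Hom((ℂ^N)^{⊗k}, (ℂ^N)^{⊗ℓ})` closed under tensor products, composition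
and adjoints, containing the identity of `ℂ^N` and the cup. -/
structure TKDual (N : ℕ) where
  C : ∀ k ℓ : ℕ, Submodule ℂ (Mat N k ℓ)
  tensor_mem : ∀ {k ℓ k' ℓ' : ℕ} {S : Mat N k ℓ} {T : Mat N k' ℓ'},
    S ∈ C k ℓ → T ∈ C k' ℓ' → tensorMat S T ∈ C (k + k') (ℓ + ℓ')
  comp_mem : ∀ {k ℓ r : ℕ} {S : Mat N ℓ r} {T : Mat N k ℓ},
    S ∈ C ℓ r → T ∈ C k ℓ → S * T ∈ C k r
  adj_mem : ∀ {k ℓ : ℕ} {T : Mat N k ℓ}, T ∈ C k ℓ → T.conjTranspose ∈ C ℓ k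
  id_mem : (1 : Matrix (Fin 1 → Fin N) (Fin 1 → Fin N) ℂ) ∈ C 1 1
  cup_mem : cupMat N ∈ C 2 0

/-- The involution of `Fin (k + ℓ)` fixing the first `k` (upper) points and
reversing the order of the last `ℓ` (lower) points. -/
def lowerRev (k ℓ : ℕ) : Fin (k + ℓ) → Fin (k + ℓ) :=
  Fin.append (fun a : Fin k => Fin.castAdd ℓ a) (fun a : Fin ℓ => Fin.natAdd k a.rev)

/-- A partition of `[k + ℓ]` (first `k` points upper, last `ℓ` points lower) is
noncrossing when the partition obtained by reversing the order of the lower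
points has no crossing. -/
def IsNCPart {k ℓ : ℕ} (p : Finpartition (Finset.univ : Finset (Fin (k + ℓ)))) : Prop :=
  ∀ κ, ¬ IsCross (fun x y => PartRel p (lowerRev k ℓ x) (lowerRev k ℓ y)) κ

/-- The linear map `T_p : (ℂ^N)^{⊗k} → (ℂ^N)^{⊗ℓ}` of a partition `p` of `[k + ℓ]`:
its entry at (lower tuple `i`, upper tuple `j`) is `1` if the labelling of the points
of `p` by `j` on the upper points and `i` on the lower points is constant on each
block of `p`, and `0` otherwise. -/
noncomputable def Tmat (N : ℕ) (k ℓ : ℕ)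
    (p : Finpartition (Finset.univ : Finset (Fin (k + ℓ)))) : Mat N k ℓ :=
  fun i j => if ∀ x y, PartRel p x y → Fin.append j i x = Fin.append j i y then 1 else 0

/-- The family `P(k,ℓ) = span{T_p : p a partition of [k+ℓ]}`. -/
noncomputable def Pfam (N k ℓ : ℕ) : Submodule ℂ (Mat N k ℓ) :=
  Submodule.span ℂ (Set.range (Tmat N k ℓ))

/-- The family `NC(k,ℓ) = span{T_p : p a noncrossing partition of [k+ℓ]}`. -/
noncomputable def NCfam (N k ℓ : ℕ) : Submodule ℂ (Mat N k ℓ) :=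
  Submodule.span ℂ {T | ∃ p, IsNCPart p ∧ T = Tmat N k ℓ p}

/-- A vector in `(ℂ^N)^{⊗k}` viewed as a linear map `(ℂ^N)^{⊗0} → (ℂ^N)^{⊗k}`. -/
def vecMat {N k : ℕ} (v : (Fin k → Fin N) → ℂ) : Mat N 0 k := fun i _ => v i

/-- `⟨NC, ξ⟩`: the smallest Tannaka–Krein dual containing all of `NC` together with
the vector `ξ ∈ (ℂ^N)^{⊗k}` (in degree `(0,k)`), i.e. the intersection of all such. -/
noncomputable def genNCxi (N : ℕ) {k : ℕ} (ξ : (Fin k → Fin N) → ℂ) (k' ℓ' : ℕ) :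
    Submodule ℂ (Mat N k' ℓ') :=
  ⨅ (C : TKDual N) (_ : ∀ a b, NCfam N a b ≤ C.C a b) (_ : vecMat ξ ∈ C.C 0 k),
    C.C k' ℓ'

section Partitions

variable {n : ℕ} {p : Finpartition (Finset.univ : Finset (Fin n))}

lemma partRel_iff {x y : Fin n} : PartRel p x y ↔ p.part x = p.part y := by
  rw [← p.mem_part_iff_part_eq_part (Finset.mem_univ x) (Finset.mem_univ y),
    Finpartition.mem_part_iff_exists]
  rfl

lemma partRel_equivalence : Equivalence (PartRel p) where
  refl _ := partRel_iff.2 rfl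
  symm h := partRel_iff.2 (partRel_iff.1 h).symm
  trans h h' := partRel_iff.2 ((partRel_iff.1 h).trans (partRel_iff.1 h'))

lemma partRel_ofSetoid (s : Setoid (Fin n)) (x y : Fin n) :
    PartRel (Finpartition.ofSetoid s) x y ↔ s x y := by
  rw [← Finpartition.mem_part_ofSetoid_iff_rel, Finpartition.mem_part_iff_exists]
  exact exists_congr fun _ => and_congr_right fun _ => and_comm

end Partitions

/-- The matrix of labellings of `k + ℓ` points respecting an arbitrary relation `r`. -/
noncomputable def relMat (N k ℓ : ℕ) (r : Fin (k + ℓ) → Fin (k + ℓ) → Prop) : Mat N k ℓ :=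
  fun i j => if ∀ x y, r x y → Fin.append j i x = Fin.append j i y then 1 else 0

lemma mem_of_entries {N k ℓ : ℕ} {V : Submodule ℂ (Mat N k ℓ)} {S T : Mat N k ℓ}
    (h : ∀ i j, S i j = T i j) (hT : T ∈ V) : S ∈ V := Matrix.ext h ▸ hT

lemma relMat_mem_Pfam (N k ℓ : ℕ) (r : Fin (k + ℓ) → Fin (k + ℓ) → Prop) :
    relMat N k ℓ r ∈ Pfam N k ℓ := by
  refine Submodule.subset_span ⟨Finpartition.ofSetoid (Relation.EqvGen.setoid r), ?_⟩
  ext i j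
  refine if_congr ?_ rfl rfl
  simp only [partRel_ofSetoid]
  constructor
  · intro h x y hxy
    exact h x y (Relation.EqvGen.rel _ _ hxy)
  · intro h x y hxy
    exact Setoid.eqvGen_le (s := Setoid.ker (Fin.append j i)) h hxy

section PositionLabels

variable {β : Type*} {k ℓ : ℕ}

/-- The matrix of the partition of `k` upper and `ℓ` lower points whose blocks are the fibres
of the labelling `g` of the positions, read from left to right above and then from right to
left below. -/
noncomputable def posMat (N k ℓ : ℕ) (g : ℕ → β) : Mat N k ℓ := fun i j =>
  if (∀ x y : Fin k, g x = g y → j x = j y) ∧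
      (∀ (x : Fin k) (y : Fin ℓ), g x = g (k + ℓ - 1 - y) → j x = i y) ∧
      (∀ x y : Fin ℓ, g (k + ℓ - 1 - x) = g (k + ℓ - 1 - y) → i x = i y) then 1 else 0

lemma lowerRev_castAdd (a : Fin k) : lowerRev k ℓ (Fin.castAdd ℓ a) = Fin.castAdd ℓ a := by
  simp [lowerRev]

lemma lowerRev_natAdd (a : Fin ℓ) : lowerRev k ℓ (Fin.natAdd k a) = Fin.natAdd k a.rev := by
  simp [lowerRev]

lemma lowerRev_lowerRev (x : Fin (k + ℓ)) : lowerRev k ℓ (lowerRev k ℓ x) = x := by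
  refine Fin.addCases (fun a => ?_) (fun a => ?_) x
  · simp only [lowerRev_castAdd]
  · simp only [lowerRev_natAdd, Fin.rev_rev]

lemma val_lowerRev_natAdd (a : Fin ℓ) :
    (lowerRev k ℓ (Fin.natAdd k a) : ℕ) = k + ℓ - 1 - a := by
  simp only [lowerRev_natAdd, Fin.val_natAdd, Fin.val_rev]
  lia

lemma posMat_mem_NCfam (N : ℕ) (g : ℕ → β)
    (hg : ∀ a b c d, a < b → b < c → c < d → d < k + ℓ → g a = g c → g b = g d → g a = g b) :
    posMat N k ℓ g ∈ NCfam N k ℓ := by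
  refine Submodule.subset_span ⟨Finpartition.ofSetoid
    (Setoid.ker fun x => g (lowerRev k ℓ x)), ?_, ?_⟩
  · rintro κ ⟨a, b, c, d, hab, hbc, hcd, -, hac, hbd, hn⟩
    simp only [partRel_ofSetoid, Setoid.ker_def, lowerRev_lowerRev] at hac hbd hn
    exact hn (hg a b c d hab hbc hcd d.2 hac hbd)
  · ext i j
    refine if_congr ?_ rfl rfl
    simp only [partRel_ofSetoid, Setoid.ker_def, Fin.forall_fin_add, Fin.append_left,
      Fin.append_right, lowerRev_castAdd, val_lowerRev_natAdd, Fin.val_castAdd]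
    constructor
    · rintro ⟨h1, h2, h3⟩
      exact ⟨fun x => ⟨h1 x, h2 x⟩, fun y => ⟨fun x h => (h2 x y h.symm).symm, h3 y⟩⟩
    · intro ⟨h1, h2⟩
      exact ⟨fun x => (h1 x).1, fun x => (h1 x).2, fun x => (h2 x).2⟩

end PositionLabels

section Invariants

/-- The Tannaka–Krein dual of all maps that commute with the permutations of the basis. -/
def permInvariants (N : ℕ) : TKDual N where
  C k ℓ :=
    { carrier := {T | ∀ (σ : Equiv.Perm (Fin N)) i j, T (σ ∘ i) (σ ∘ j) = T i j}
      add_mem' := fun hS hT σ i j => congrArg₂ (· + ·) (hS σ i j) (hT σ i j)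
      zero_mem' := fun _ _ _ => rfl
      smul_mem' := fun c _ hT σ i j => congrArg (c • ·) (hT σ i j) }
  tensor_mem hS hT σ i j := congrArg₂ (· * ·) (hS σ _ _) (hT σ _ _)
  comp_mem {k ℓ r S T} hS hT σ i j := by
    rw [Matrix.mul_apply, Matrix.mul_apply,
      ← (Equiv.arrowCongr (Equiv.refl (Fin ℓ)) σ).sum_comp]
    exact Finset.sum_congr rfl fun m _ => congrArg₂ (· * ·) (hS σ i m) (hT σ m j)
  adj_mem hT σ i j := congrArg star (hT σ j i)
  id_mem σ i j := by
    simp only [Matrix.one_apply, σ.injective.comp_left.eq_iff]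
  cup_mem σ i j := by simp [cupMat]

lemma NCfam_le_permInvariants (N k ℓ : ℕ) : NCfam N k ℓ ≤ (permInvariants N).C k ℓ := by
  refine Submodule.span_le.2 ?_
  rintro _ ⟨p, -, rfl⟩ σ i j
  refine if_congr ?_ rfl rfl
  have h : Fin.append (σ ∘ j) (σ ∘ i) = σ ∘ Fin.append j i := by
    ext x; refine Fin.addCases (fun a => ?_) (fun a => ?_) x <;> simp
  simp [h]

lemma vecMat_xi_mem_permInvariants (N : ℕ) {k : ℕ}
    (p : Finpartition (Finset.univ : Finset (Fin k))) :
    vecMat (xi N p) ∈ (permInvariants N).C 0 k := fun σ i _ =>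
  if_congr (by simp) rfl rfl

variable {N k ℓ : ℕ}

lemma mul_delta_mem_Pfam (x y : Fin (k + ℓ)) {T : Mat N k ℓ} (hT : T ∈ Pfam N k ℓ) :
    (Matrix.of fun i j => if Fin.append j i x = Fin.append j i y then T i j else 0) ∈
      Pfam N k ℓ := by
  induction hT using Submodule.span_induction with
  | mem T hT =>
    obtain ⟨p, rfl⟩ := hT
    refine mem_of_entries ?_
      (relMat_mem_Pfam N k ℓ fun u v => PartRel p u v ∨ (u = x ∧ v = y))
    intro i j
    simp only [Matrix.of_apply, relMat, Tmat]
    split_ifs <;> grind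
  | zero =>
    refine mem_of_entries ?_ (Submodule.zero_mem (Pfam N k ℓ))
    intro i j
    simp
  | add S T _ _ hS hT =>
    refine mem_of_entries ?_ (Submodule.add_mem _ hS hT)
    intro i j
    simp only [Matrix.add_apply, Matrix.of_apply]
    split_ifs <;> simp
  | smul c T _ hT =>
    refine mem_of_entries ?_ (Submodule.smul_mem _ c hT)
    intro i j
    simp only [Matrix.smul_apply, Matrix.of_apply]
    split_ifs <;> simp

lemma indicator_mem_Pfam (s : Fin (k + ℓ) → Fin (k + ℓ) → Prop)
    (S : Finset (Fin (k + ℓ) × Fin (k + ℓ))) :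
    (Matrix.of fun i j => if ∀ q ∈ S, (Fin.append j i q.1 = Fin.append j i q.2 ↔ s q.1 q.2)
      then 1 else 0 : Mat N k ℓ) ∈ Pfam N k ℓ := by
  induction S using Finset.induction_on with
  | empty =>
    refine mem_of_entries ?_ (relMat_mem_Pfam N k ℓ fun _ _ => False)
    intro i j
    simp [relMat]
  | insert q S _ ih =>
    have hδ := mul_delta_mem_Pfam q.1 q.2 ih
    by_cases hq : s q.1 q.2
    · refine mem_of_entries ?_ hδ
      intro i j
      simp only [Finset.forall_mem_insert, hq, iff_true, Matrix.of_apply]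
      split_ifs <;> tauto
    · refine mem_of_entries ?_ (Submodule.sub_mem _ ih hδ)
      intro i j
      simp only [Finset.forall_mem_insert, hq, iff_false, Matrix.sub_apply, Matrix.of_apply]
      split_ifs <;> first | tauto | simp

lemma exists_perm_comp_eq {n : ℕ} {z w : Fin n → Fin N}
    (h : ∀ x y, z x = z y ↔ w x = w y) : ∃ σ : Equiv.Perm (Fin N), σ ∘ z = w := by
  obtain ⟨σ, hσ⟩ := Equiv.Perm.exists_extending_pair
    (Quotient.lift z (fun _ _ hab => hab) : Quotient (Setoid.ker z) → Fin N)
    (Quotient.lift w (fun a b hab => (h a b).1 hab))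
    (fun a b => Quotient.inductionOn₂ a b fun _ _ hab => Quotient.sound hab)
    (fun a b => Quotient.inductionOn₂ a b fun _ _ hab => Quotient.sound ((h _ _).2 hab))
  exact ⟨σ, funext fun x => hσ (Quotient.mk _ x)⟩

lemma permInvariants_le_Pfam (N k ℓ : ℕ) : (permInvariants N).C k ℓ ≤ Pfam N k ℓ := by
  intro T hT
  let R : (Fin ℓ → Fin N) × (Fin k → Fin N) → (Fin ℓ → Fin N) × (Fin k → Fin N) → Prop :=
    fun z w => ∀ x y, Fin.append w.2 w.1 x = Fin.append w.2 w.1 y ↔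
      Fin.append z.2 z.1 x = Fin.append z.2 z.1 y
  let c : (Fin ℓ → Fin N) × (Fin k → Fin N) → ℂ := fun z => ∑ w, if R w z then 1 else 0
  have hR : ∀ {z w}, R z w → T z.1 z.2 = T w.1 w.2 := by
    intro z w h
    obtain ⟨σ, hσ⟩ := exists_perm_comp_eq fun x y => (h x y).symm
    have h1 : σ ∘ z.1 = w.1 := funext fun a => by
      simpa using congrFun hσ (Fin.natAdd k a)
    have h2 : σ ∘ z.2 = w.2 := funext fun a => by
      simpa using congrFun hσ (Fin.castAdd ℓ a)
    rw [← h1, ← h2, hT]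
  have hc : ∀ {z w}, R z w → c z = c w := fun {z w} h =>
    Finset.sum_congr rfl fun u _ => if_congr
      ⟨fun h' x y => (h x y).trans (h' x y), fun h' x y => (h x y).symm.trans (h' x y)⟩ rfl rfl
  have hc0 : ∀ z, c z ≠ 0 := fun z => by
    change (∑ w, if R w z then (1 : ℂ) else 0) ≠ 0
    rw [Finset.sum_boole, Nat.cast_ne_zero, ne_eq, Finset.card_eq_zero]
    exact fun h => Finset.filter_eq_empty_iff.1 h (Finset.mem_univ z) fun _ _ => Iff.rfl
  have key : T = ∑ z : (Fin ℓ → Fin N) × (Fin k → Fin N), (T z.1 z.2 / c z) •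
      (Matrix.of fun i j => if R z (i, j) then 1 else 0 : Mat N k ℓ) := by
    ext i j
    rw [Matrix.sum_apply]
    have : ∀ z : (Fin ℓ → Fin N) × (Fin k → Fin N), ((T z.1 z.2 / c z) •
        (Matrix.of fun i j => if R z (i, j) then 1 else 0 : Mat N k ℓ)) i j =
        T i j / c (i, j) * if R z (i, j) then 1 else 0 := by
      intro z
      rw [Matrix.smul_apply, smul_eq_mul, Matrix.of_apply]
      split_ifs with h
      · rw [hR h, hc h]
      · simp
    rw [Finset.sum_congr rfl fun z _ => this z, ← Finset.mul_sum]
    exact (div_mul_cancel₀ _ (hc0 (i, j))).symm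
  rw [key]
  refine Submodule.sum_mem _ fun z _ => Submodule.smul_mem _ _ ?_
  refine mem_of_entries ?_ (indicator_mem_Pfam
    (fun x y => Fin.append z.2 z.1 x = Fin.append z.2 z.1 y) Finset.univ)
  intro i j
  simp [R]

end Invariants

section Generation

variable {N : ℕ} {D : TKDual N}

lemma posMat_eq_one {β : Type*} {k ℓ : ℕ} {g : ℕ → β} {i : Fin ℓ → Fin N} {j : Fin k → Fin N}
    (h : β → Option (Fin N)) (hj : ∀ x : Fin k, h (g x) = some (j x))
    (hi : ∀ y : Fin ℓ, h (g (k + ℓ - 1 - y)) = some (i y)) : posMat N k ℓ g i j = 1 := by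
  refine if_pos ⟨fun x y e => ?_, fun x y e => ?_, fun x y e => ?_⟩ <;>
    apply Option.some_injective
  · rw [← hj, ← hj, e]
  · rw [← hj, ← hi, e]
  · rw [← hi, ← hi, e]

lemma interval_mem (hNC : ∀ a b, NCfam N a b ≤ D.C a b) (n : ℕ) (f : ℕ → ℕ) (hf : Monotone f) :
    (Matrix.of fun i j => if ∀ x y : Fin n, f x = f y → j x = i y then 1 else 0 : Mat N n n) ∈
      D.C n n := by
  refine mem_of_entries ?_ (hNC _ _ (posMat_mem_NCfam N
    (fun z => f (if z < n then z else 2 * n - 1 - z)) ?_))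
  · intro i j
    have hu : ∀ x : Fin n, (if (x : ℕ) < n then (x : ℕ) else 2 * n - 1 - x) = x :=
      fun x => if_pos x.2
    have hl : ∀ x : Fin n, (if n + n - 1 - (x : ℕ) < n then n + n - 1 - (x : ℕ)
        else 2 * n - 1 - (n + n - 1 - x)) = x := fun x => by split_ifs <;> lia
    simp only [posMat, Matrix.of_apply, hu, hl]
    refine if_congr ⟨fun h => ⟨fun x y e => ?_, h, fun x y e => ?_⟩, fun h => h.2.1⟩ rfl rfl
    · rw [h x y e, h y y rfl]
    · rw [← h x x rfl, h x y e]
  · intro a b c d hab hbc hcd hd hac hbd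
    have hmono : ∀ x y, x ≤ y → f x ≤ f y := fun x y h => hf h
    generalize hA : (if a < n then a else 2 * n - 1 - a) = A at *
    generalize hB : (if b < n then b else 2 * n - 1 - b) = B at *
    generalize hC : (if c < n then c else 2 * n - 1 - c) = C at *
    generalize hD : (if d < n then d else 2 * n - 1 - d) = E at *
    have h1 := hmono A B
    have h2 := hmono B C
    have h3 := hmono C B
    have h4 := hmono E C
    split_ifs at hA hB hC hD <;> lia

lemma one_mem (hNC : ∀ a b, NCfam N a b ≤ D.C a b) (n : ℕ) : (1 : Mat N n n) ∈ D.C n n := by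
  refine mem_of_entries (fun i j => ?_) (interval_mem hNC n id monotone_id)
  rw [Matrix.one_apply, Matrix.of_apply]
  refine if_congr ?_ rfl rfl
  simp only [funext_iff, id, Fin.val_inj, forall_eq', eq_comm (a := i _)]

lemma ones_mem (hNC : ∀ a b, NCfam N a b ≤ D.C a b) (n : ℕ) :
    (Matrix.of fun _ _ => 1 : Mat N 0 n) ∈ D.C 0 n := by
  refine mem_of_entries (fun i j => ?_) (hNC _ _ (posMat_mem_NCfam N (fun z => z) ?_))
  · refine (if_pos ⟨fun x => x.elim0, fun x => x.elim0, fun x y e => ?_⟩).symm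
    exact congrArg i (Fin.ext (by lia))
  · intros; lia

/-- The labels of the noncrossing pairing of `2 * k + ℓ` upper and `ℓ` lower points that caps off
the first `2 * k` upper points by nested arcs and leaves the other points in place. -/
def bendLabel (k ℓ z : ℕ) : ℕ :=
  if z < k then z else if z < 2 * k then 2 * k - 1 - z
    else if z < 2 * k + ℓ then z else 4 * k + 2 * ℓ - 1 - z

lemma bendLabel_noncrossing {k ℓ a b c d : ℕ} (hab : a < b) (hbc : b < c) (hcd : c < d)
    (hd : d < k + (k + ℓ) + ℓ) (hac : bendLabel k ℓ a = bendLabel k ℓ c)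
    (hbd : bendLabel k ℓ b = bendLabel k ℓ d) : bendLabel k ℓ a = bendLabel k ℓ b := by
  unfold bendLabel at *
  split_ifs at * <;> lia

lemma bendLabel_castAdd {k ℓ : ℕ} (a : Fin k) : bendLabel k ℓ (Fin.castAdd (k + ℓ) a) = a :=
  if_pos a.2

lemma bendLabel_natAdd_castAdd {k ℓ : ℕ} (a : Fin k) :
    bendLabel k ℓ (Fin.natAdd k (Fin.castAdd ℓ a)) = a.rev := by
  simp only [bendLabel, Fin.val_natAdd, Fin.val_castAdd, Fin.val_rev]
  split_ifs <;> lia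

lemma bendLabel_natAdd_natAdd {k ℓ : ℕ} (a : Fin ℓ) :
    bendLabel k ℓ (Fin.natAdd k (Fin.natAdd k a)) = 2 * k + a := by
  simp only [bendLabel, Fin.val_natAdd]
  split_ifs <;> lia

lemma bendLabel_lower {k ℓ : ℕ} (a : Fin ℓ) :
    bendLabel k ℓ (k + (k + ℓ) + ℓ - 1 - a) = 2 * k + a := by
  unfold bendLabel
  split_ifs <;> lia

lemma posMat_bendLabel {k ℓ : ℕ} (i : Fin ℓ → Fin N) (j : Fin k → Fin N) :
    posMat N (k + (k + ℓ)) ℓ (bendLabel k ℓ) i (Fin.append j (Fin.append (j ∘ Fin.rev) i)) = 1 := by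
  refine posMat_eq_one (fun z => if h : z < k then some (j ⟨z, h⟩) else
    if h : z - 2 * k < ℓ then some (i ⟨z - 2 * k, h⟩) else none) ?_ fun a => ?_
  · simp only [Fin.forall_fin_add]
    refine ⟨fun a => ?_, fun a => ?_, fun a => ?_⟩
    · simp only [bendLabel_castAdd, a.2, dif_pos, Fin.append_left]
    · simp only [bendLabel_natAdd_castAdd, a.rev.2, dif_pos, Fin.append_left, Fin.append_right,
        Function.comp]
    · have h : ¬ 2 * k + (a : ℕ) < k := by lia
      simp only [bendLabel_natAdd_natAdd, h, Nat.add_sub_cancel_left, a.2, dif_pos,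
        Fin.append_right, dif_neg, not_false_eq_true]
  · have h : ¬ 2 * k + (a : ℕ) < k := by lia
    simp only [bendLabel_lower, h, Nat.add_sub_cancel_left, a.2, dif_pos, dif_neg,
      not_false_eq_true]

/-- Frobenius reciprocity: the first `k` lower points are bent up. -/
lemma unbend_mem (hNC : ∀ a b, NCfam N a b ≤ D.C a b) {k ℓ : ℕ} {v : Mat N 0 (k + ℓ)}
    (hv : v ∈ D.C 0 (k + ℓ)) :
    (Matrix.of fun i j => v (Fin.append (j ∘ Fin.rev) i) Fin.elim0 : Mat N k ℓ) ∈ D.C k ℓ := by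
  refine mem_of_entries (fun i j => ?_) (D.comp_mem
    (hNC _ _ (posMat_mem_NCfam N (bendLabel k ℓ) fun _ _ _ _ => bendLabel_noncrossing))
    (D.tensor_mem (one_mem hNC k) hv))
  change _ = ∑ m, _ * _
  rw [Finset.sum_eq_single (Fin.append j (Fin.append (j ∘ Fin.rev) i))]
  · rw [posMat_bendLabel, one_mul]
    simp only [tensorMat, Matrix.one_apply, Fin.append_left, Fin.append_right, Matrix.of_apply]
    rw [if_pos (show (fun a => j a) = fun b => j (Fin.castAdd 0 b) from rfl), one_mul]
    exact congrArg _ (Subsingleton.elim _ _)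
  · intro m _ hm
    by_contra hne
    obtain ⟨h1, h2⟩ := mul_ne_zero_iff.1 hne
    have hj : (fun a => m (Fin.castAdd (k + ℓ) a)) = j := by
      by_contra h
      refine h2 ?_
      rw [tensorMat, Matrix.one_apply_ne, zero_mul]
      exact h
    obtain ⟨hp, hq, -⟩ := of_not_not fun h => h1 (if_neg h)
    refine hm (funext ((Fin.forall_fin_add _).2 ⟨fun a => ?_, (Fin.forall_fin_add _).2
      ⟨fun a => ?_, fun a => ?_⟩⟩))
    · simpa using congrFun hj a
    · rw [Fin.append_right, Fin.append_left, Function.comp, ← hj]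
      exact hp _ _ (by rw [bendLabel_natAdd_castAdd, bendLabel_castAdd])
    · rw [Fin.append_right, Fin.append_right]
      exact hq _ _ (by rw [bendLabel_natAdd_natAdd, bendLabel_lower])
  · exact fun h => (h (Finset.mem_univ _)).elim

lemma conj_perm_mem {n : ℕ} {σ : Equiv.Perm (Fin n)} {A : Mat N n n}
    (hσ : (Matrix.of fun i j => if i = j ∘ σ then 1 else 0 : Mat N n n) ∈ D.C n n)
    (hinv : Function.Involutive σ) (hA : A ∈ D.C n n) :
    (Matrix.of fun i j => A (i ∘ σ) (j ∘ σ)) ∈ D.C n n := by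
  refine mem_of_entries (fun i j => ?_) (D.comp_mem (D.comp_mem hσ hA) hσ)
  have h : ∀ i m : Fin n → Fin N, i = m ∘ σ ↔ i ∘ σ = m := fun i m => by
    constructor
    · rintro rfl; ext x; simp [hinv x]
    · rintro rfl; ext x; simp [hinv x]
  have hl : ∀ (B : Mat N n n) i j,
      ((Matrix.of fun i j => if i = j ∘ σ then 1 else 0 : Mat N n n) * B) i j = B (i ∘ σ) j :=
    fun B i j => by simp [Matrix.mul_apply, h]
  have hr : ∀ (B : Mat N n n) i j,
      (B * (Matrix.of fun i j => if i = j ∘ σ then 1 else 0 : Mat N n n)) i j = B i (j ∘ σ) :=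
    fun B i j => by simp [Matrix.mul_apply]
  rw [hr, hl, Matrix.of_apply]

lemma swap_adjacent_mem (hNC : ∀ a b, NCfam N a b ≤ D.C a b) {n t : ℕ} (ht : t + 1 < n)
    (hX : (Matrix.of fun z _ => if z 0 = z 2 ∧ z 1 = z 3 then 1 else 0 : Mat N 0 4) ∈ D.C 0 4) :
    (Matrix.of fun i j => if i = j ∘ Equiv.swap ⟨t, by lia⟩ ⟨t + 1, ht⟩ then 1 else 0 : Mat N n n) ∈
      D.C n n := by
  obtain ⟨b, rfl⟩ : ∃ b, n = t + 2 + b := ⟨n - (t + 2), by lia⟩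
  have hS : (Matrix.of fun i j => if j 1 = i 0 ∧ j 0 = i 1 then 1 else 0 : Mat N 2 2) ∈ D.C 2 2 :=
    mem_of_entries (fun _ _ => rfl) (unbend_mem (k := 2) (ℓ := 2) hNC hX)
  refine mem_of_entries (fun i j => ?_)
    (D.tensor_mem (D.tensor_mem (one_mem hNC t) hS) (one_mem hNC b))
  have e0 : (⟨t, by lia⟩ : Fin (t + 2 + b)) = Fin.castAdd b (Fin.natAdd t 0) := rfl
  have e1 : (⟨t + 1, ht⟩ : Fin (t + 2 + b)) = Fin.castAdd b (Fin.natAdd t 1) := rfl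
  rw [e0, e1]
  have key : i = j ∘ Equiv.swap (Fin.castAdd b (Fin.natAdd t 0)) (Fin.castAdd b (Fin.natAdd t 1)) ↔
      ((fun a => i (Fin.castAdd b (Fin.castAdd 2 a))) =
          fun a => j (Fin.castAdd b (Fin.castAdd 2 a))) ∧
        (j (Fin.castAdd b (Fin.natAdd t 1)) = i (Fin.castAdd b (Fin.natAdd t 0)) ∧
          j (Fin.castAdd b (Fin.natAdd t 0)) = i (Fin.castAdd b (Fin.natAdd t 1))) ∧
        (fun a => i (Fin.natAdd (t + 2) a)) = fun a => j (Fin.natAdd (t + 2) a) := by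
    have n1 : ∀ (a : Fin t) (s : Fin 2),
        Fin.castAdd b (Fin.castAdd 2 a) ≠ Fin.castAdd b (Fin.natAdd t s) := fun a s h => by
      simp only [Fin.ext_iff, Fin.val_castAdd, Fin.val_natAdd] at h; lia
    have n2 : ∀ (a : Fin b) (s : Fin 2),
        Fin.natAdd (t + 2) a ≠ Fin.castAdd b (Fin.natAdd t s) := fun a s h => by
      simp only [Fin.ext_iff, Fin.val_castAdd, Fin.val_natAdd] at h; lia
    rw [funext_iff, Fin.forall_fin_add, Fin.forall_fin_add, Fin.forall_fin_two]
    simp only [Function.comp, Equiv.swap_apply_left, Equiv.swap_apply_right,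
      Equiv.swap_apply_of_ne_of_ne (n1 _ 0) (n1 _ 1),
      Equiv.swap_apply_of_ne_of_ne (n2 _ 0) (n2 _ 1), funext_iff]
    grind
  simp only [Matrix.of_apply, tensorMat, Matrix.one_apply, key, ite_and]
  split_ifs <;> simp

lemma delta_mem (hNC : ∀ a b, NCfam N a b ≤ D.C a b) {n : ℕ}
    (hX : (Matrix.of fun z _ => if z 0 = z 2 ∧ z 1 = z 3 then 1 else 0 : Mat N 0 4) ∈ D.C 0 4)
    (x y : Fin n) :
    (Matrix.of fun i j => if i = j ∧ i x = i y then 1 else 0 : Mat N n n) ∈ D.C n n := by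
  wlog hxy : x ≤ y generalizing x y
  · refine mem_of_entries (fun i j => ?_) (this y x (le_of_not_ge hxy))
    simp only [Matrix.of_apply, eq_comm]
  obtain ⟨d, hd⟩ := Nat.exists_eq_add_of_le (Fin.le_def.1 hxy)
  induction d generalizing y with
  | zero =>
    obtain rfl : y = x := Fin.ext hd
    refine mem_of_entries (fun i j => ?_) (one_mem hNC n)
    simp [Matrix.one_apply]
  | succ d ih =>
    have hy : (x : ℕ) + d + 1 < n := by lia
    obtain rfl : y = ⟨x + d + 1, hy⟩ := Fin.ext hd
    rcases Nat.eq_zero_or_pos d with rfl | hpos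
    · refine mem_of_entries (fun i j => ?_) (interval_mem hNC n
        (fun z => if z ≤ x then z else z - 1) ?_)
      · rw [Matrix.of_apply, Matrix.of_apply]
        refine if_congr ⟨?_, fun h => ?_⟩ rfl rfl
        · rintro ⟨rfl, h⟩ u v huv
          have : u = v ∨ (u = x ∧ v = ⟨x + 0 + 1, hy⟩) ∨ (v = x ∧ u = ⟨x + 0 + 1, hy⟩) := by
            simp only [Fin.ext_iff]
            split_ifs at huv <;> lia
          rcases this with rfl | ⟨rfl, rfl⟩ | ⟨rfl, rfl⟩
          exacts [rfl, h, h.symm]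
        · have hij : i = j := funext fun u => (h u u rfl).symm
          refine ⟨hij, ?_⟩
          rw [← h x ⟨x + 0 + 1, hy⟩ (by simp), hij]
      · intro u v huv
        simp only
        split_ifs <;> lia
    · have hne : x ≠ ⟨x + d, by lia⟩ ∧ x ≠ ⟨x + d + 1, hy⟩ := by
        simp only [ne_eq, Fin.ext_iff]; lia
      refine mem_of_entries (fun i j => ?_) (conj_perm_mem
        (swap_adjacent_mem hNC (t := x + d) hy hX) (fun z => Equiv.swap_apply_self _ _ z)
        (ih ⟨x + d, by lia⟩ (Fin.le_def.2 (Nat.le_add_right _ _)) rfl))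
      simp only [Matrix.of_apply, Function.comp, Equiv.swap_apply_left,
        Equiv.swap_apply_of_ne_of_ne hne.1 hne.2]
      refine if_congr (and_congr_left fun _ => ?_) rfl rfl
      exact ((Equiv.swap _ _).surjective.injective_comp_right.eq_iff).symm

lemma Pfam_le_of_cross_mem (hNC : ∀ a b, NCfam N a b ≤ D.C a b)
    (hX : (Matrix.of fun z _ => if z 0 = z 2 ∧ z 1 = z 3 then 1 else 0 : Mat N 0 4) ∈ D.C 0 4)
    (k ℓ : ℕ) : Pfam N k ℓ ≤ D.C k ℓ := by
  have hvec : ∀ (n : ℕ) (S : Finset (Fin n × Fin n)),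
      (Matrix.of fun z _ => if ∀ q ∈ S, z q.1 = z q.2 then 1 else 0 : Mat N 0 n) ∈ D.C 0 n := by
    intro n S
    induction S using Finset.induction_on with
    | empty => simpa using ones_mem hNC n
    | insert q S _ ih =>
      refine mem_of_entries (fun z _ => ?_) (D.comp_mem (delta_mem hNC hX q.1 q.2) ih)
      simp only [Matrix.mul_apply, Matrix.of_apply, Finset.forall_mem_insert, ite_and, ite_mul,
        one_mul, zero_mul, Finset.sum_ite_eq, Finset.mem_univ, if_true]
  refine Submodule.span_le.2 ?_
  rintro _ ⟨p, rfl⟩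
  let ρ : Fin (k + ℓ) → Fin (k + ℓ) :=
    Fin.append (fun a => Fin.castAdd ℓ a.rev) (fun a => Fin.natAdd k a)
  have hρ : ∀ x, ρ (ρ x) = x := fun x => by
    refine Fin.addCases (fun a => ?_) (fun a => ?_) x <;> simp [ρ]
  refine mem_of_entries (fun i j => ?_) (unbend_mem hNC (hvec (k + ℓ)
    (Finset.univ.filter fun q => PartRel p (ρ q.1) (ρ q.2))))
  have happ : ∀ x, Fin.append (j ∘ Fin.rev) i x = Fin.append j i (ρ x) := fun x => by
    refine Fin.addCases (fun a => ?_) (fun a => ?_) x <;> simp [ρ]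
  simp only [Matrix.of_apply, Tmat, Finset.mem_filter, Finset.mem_univ, true_and, happ]
  refine if_congr ⟨fun h q hq => h _ _ hq, fun h x y hxy => ?_⟩ rfl rfl
  simpa only [hρ] using h (ρ x, ρ y) (by simpa only [hρ] using hxy)

end Generation

section Restriction

variable {N k : ℕ}

lemma restrict_mem {D : TKDual N} (hNC : ∀ a b, NCfam N a b ≤ D.C a b) {e : Fin 4 → Fin k}
    (he : StrictMono e) :
    (Matrix.of fun i x => if x ∘ e = i then 1 else 0 : Mat N k 4) ∈ D.C k 4 := by
  obtain ⟨E, hE⟩ : ∃ E : ℕ → ℕ, ∀ s : Fin 4, E s = e s :=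
    ⟨fun s => e (Fin.ofNat 4 s), fun s =>
      congrArg (fun t => (e t : ℕ)) (Fin.ofNat_val_eq_self s)⟩
  have hlt : ∀ s t, s < t → t < 4 → E s < E t := fun s t hst ht => by
    rw [hE ⟨s, hst.trans ht⟩, hE ⟨t, ht⟩]
    exact he hst
  refine mem_of_entries (fun i x => ?_) (hNC _ _ (posMat_mem_NCfam N
    (fun z => if z < k then z else E (k + 3 - z)) ?_))
  · have hu : ∀ y : Fin k, (if (y : ℕ) < k then (y : ℕ) else E (k + 3 - y)) = y :=
      fun y => if_pos y.2
    have hl : ∀ s : Fin 4, (if k + 4 - 1 - (s : ℕ) < k then k + 4 - 1 - (s : ℕ)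
        else E (k + 3 - (k + 4 - 1 - s))) = e s := fun s => by
      rw [if_neg (by lia), show k + 3 - (k + 4 - 1 - (s : ℕ)) = s by lia, hE]
    simp only [posMat, Matrix.of_apply, hu, hl, Fin.val_inj, he.injective.eq_iff, funext_iff,
      Function.comp]
    refine if_congr ⟨fun h => ⟨?_, ?_, ?_⟩, fun h s => h.2.1 _ s rfl⟩ rfl rfl
    · rintro y _ rfl; rfl
    · rintro _ s rfl; exact h s
    · rintro s _ rfl; rfl
  · intro a b c d hab hbc hcd hd hac hbd
    have h1 := hlt (k + 3 - d) (k + 3 - c)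
    have h2 := hlt (k + 3 - d) (k + 3 - b)
    split_ifs at * <;> lia

lemma sum_restrict_xi (hN : 0 < N) {n : ℕ} (p : Finpartition (Finset.univ : Finset (Fin k)))
    (e : Fin n → Fin k) :
    ∃ c : ℂ, c ≠ 0 ∧ ∀ i : Fin n → Fin N,
      ∑ x : Fin k → Fin N, (if x ∘ e = i then 1 else 0) * xi N p x =
        if ∀ s t, PartRel p (e s) (e t) → i s = i t then c else 0 := by
  let F : (Fin n → Fin N) → Finset (Fin k → Fin N) := fun i =>
    Finset.univ.filter fun x => x ∘ e = i ∧ ∀ u v, PartRel p u v → x u = x v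
  have hsum : ∀ i, ∑ x : Fin k → Fin N, (if x ∘ e = i then 1 else 0) * xi N p x =
      ((F i).card : ℂ) := fun i => by
    simp only [F, ← Finset.sum_boole, xi, ite_and, ite_mul, one_mul, zero_mul]
  have hle : ∀ i i' : Fin n → Fin N, (∀ s t, PartRel p (e s) (e t) → i' s = i' t) →
      (F i).card ≤ (F i').card := by
    intro i i' hi'
    let φ : (Fin k → Fin N) → Fin k → Fin N := fun x u =>
      if h : ∃ s, PartRel p (e s) u then i' h.choose else x u
    have hφ : ∀ x u s, PartRel p (e s) u → φ x u = i' s := fun x u s hs => by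
      have h : ∃ s, PartRel p (e s) u := ⟨s, hs⟩
      simp only [φ, dif_pos h]
      exact hi' _ _ (partRel_equivalence.trans h.choose_spec (partRel_equivalence.symm hs))
    refine Finset.card_le_card_of_injOn φ (fun x hx => ?_) fun x hx y hy hxy => ?_
    · obtain ⟨-, -, hx⟩ := Finset.mem_filter.1 hx
      refine Finset.mem_coe.2 (Finset.mem_filter.2 ⟨Finset.mem_univ _, funext fun s =>
        hφ x _ s (partRel_equivalence.refl _), fun u v huv => ?_⟩)
      by_cases h : ∃ s, PartRel p (e s) u
      · obtain ⟨s, hs⟩ := h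
        rw [hφ x u s hs, hφ x v s (partRel_equivalence.trans hs huv)]
      · have h' : ¬ ∃ s, PartRel p (e s) v := fun ⟨s, hs⟩ =>
          h ⟨s, partRel_equivalence.trans hs (partRel_equivalence.symm huv)⟩
        simp only [φ, dif_neg h, dif_neg h']
        exact hx u v huv
    · obtain ⟨-, rfl, hx'⟩ := Finset.mem_filter.1 hx
      obtain ⟨-, hyx, hy'⟩ := Finset.mem_filter.1 hy
      funext u
      by_cases h : ∃ s, PartRel p (e s) u
      · obtain ⟨s, hs⟩ := h
        rw [← hx' _ _ hs, ← hy' _ _ hs]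
        exact (congrFun hyx s).symm
      · simpa only [φ, dif_neg h] using congrFun hxy u
  let i₀ : Fin n → Fin N := fun _ => ⟨0, hN⟩
  refine ⟨(F i₀).card, ?_, fun i => ?_⟩
  · rw [Nat.cast_ne_zero]
    exact Finset.card_ne_zero_of_mem (a := fun _ => ⟨0, hN⟩)
      (Finset.mem_filter.2 ⟨Finset.mem_univ _, rfl, fun _ _ _ => rfl⟩)
  · rw [hsum]
    split_ifs with hi
    · rw [le_antisymm (hle i i₀ fun _ _ _ => rfl) (hle i₀ i hi)]
    · rw [Nat.cast_eq_zero, Finset.card_eq_zero, Finset.filter_eq_empty_iff]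
      rintro x - ⟨rfl, hx⟩
      exact hi fun s t h => hx _ _ h

lemma noncrossing_four_mem {D : TKDual N} (hNC : ∀ a b, NCfam N a b ≤ D.C a b)
    (r : Setoid (Fin 4)) (h : r 0 2 → r 1 3 → r 0 1) :
    (Matrix.of fun z _ => if ∀ s t, r s t → z s = z t then 1 else 0 : Mat N 0 4) ∈ D.C 0 4 := by
  refine mem_of_entries (fun z _ => ?_) (hNC _ _ (posMat_mem_NCfam N
    (fun z => Quotient.mk r (Fin.ofNat 4 (3 - z))) ?_))
  · have hl : ∀ s : Fin 4, Fin.ofNat 4 (3 - (0 + 4 - 1 - (s : ℕ))) = s := by decide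
    simp only [posMat, Matrix.of_apply, hl, Quotient.eq]
    exact if_congr ⟨fun h => ⟨fun x => x.elim0, fun x => x.elim0, h⟩, fun h => h.2.2⟩ rfl rfl
  · intro a b c d hab hbc hcd hd hac hbd
    obtain ⟨rfl, rfl, rfl, rfl⟩ : a = 0 ∧ b = 1 ∧ c = 2 ∧ d = 3 := by lia
    have h31 : r 3 1 := Quotient.eq.1 hac
    have h20 : r 2 0 := Quotient.eq.1 hbd
    exact Quotient.eq.2 (r.trans h31 (r.trans (r.symm (h (r.symm h20) (r.symm h31))) (r.symm h20)))

lemma forall_crossing_four (r : Setoid (Fin 4)) (h02 : r 0 2) (h13 : r 1 3) (h01 : ¬ r 0 1)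
    (z : Fin 4 → Fin N) : (∀ s t, r s t → z s = z t) ↔ z 0 = z 2 ∧ z 1 = z 3 := by
  refine ⟨fun h => ⟨h _ _ h02, h _ _ h13⟩, fun ⟨h, h'⟩ s t hst => ?_⟩
  have n03 : ¬ r 0 3 := fun g => h01 (r.trans g (r.symm h13))
  have n21 : ¬ r 2 1 := fun g => h01 (r.trans h02 g)
  have n23 : ¬ r 2 3 := fun g => n03 (r.trans h02 g)
  have sym : ∀ {a b}, ¬ r a b → ¬ r b a := fun hn g => hn (r.symm g)
  fin_cases s <;> fin_cases t <;> first
    | rfl | exact h | exact h' | exact h.symm | exact h'.symm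
    | exact absurd hst h01 | exact absurd hst n03 | exact absurd hst n21 | exact absurd hst n23
    | exact absurd hst (sym h01) | exact absurd hst (sym n03) | exact absurd hst (sym n21)
    | exact absurd hst (sym n23)

end Restriction

/-- for `N ≥ 4`, distinct partitions `p₁, …, p_m` of `[k]` and nonzero
`ξ = ∑ α_i ξ_{p_i}`, if some `p_j` has a crossing `κ` belonging to no other `p_i`,
then `α_j = 0` or `⟨NC, ξ⟩ = P`. -/
theorem stmt13 {N k m : ℕ} (hN : 4 ≤ N)
    (p : Fin m → Finpartition (Finset.univ : Finset (Fin k)))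
    (hinj : Function.Injective p)
    (α : Fin m → ℂ)
    (ξ : (Fin k → Fin N) → ℂ) (hξ : ξ = ∑ i, α i • xi N (p i)) (hne : ξ ≠ 0)
    (j : Fin m) (κ : Finset (Fin k))
    (hκj : κ ∈ cr (p j)) (hκ : ∀ i, i ≠ j → κ ∉ cr (p i)) :
    α j = 0 ∨ (∀ k' ℓ', genNCxi N ξ k' ℓ' = Pfam N k' ℓ') := by
  refine or_iff_not_imp_left.2 fun hα k' ℓ' => le_antisymm ?_ ?_
  · refine iInf_le_of_le (permInvariants N) (iInf_le_of_le (NCfam_le_permInvariants N)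
      (iInf_le_of_le ?_ (permInvariants_le_Pfam N k' ℓ')))
    subst hξ
    refine mem_of_entries (T := ∑ i, α i • vecMat (xi N (p i))) (fun x y => ?_)
      (Submodule.sum_mem _ fun i _ => Submodule.smul_mem _ _ (vecMat_xi_mem_permInvariants N (p i)))
    simp [vecMat, Matrix.sum_apply]
  refine le_iInf fun D => le_iInf fun hNC => le_iInf fun hD => Pfam_le_of_cross_mem hNC ?_ k' ℓ'
  obtain ⟨a, b, c, d, hab, hbc, hcd, rfl, hac, hbd, hn⟩ := hκj
  have he : StrictMono ![a, b, c, d] := Fin.strictMono_iff_lt_succ.2 fun s => by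
    fin_cases s
    exacts [hab, hbc, hcd]
  let r : Fin m → Setoid (Fin 4) := fun i =>
    ⟨fun s t => PartRel (p i) (![a, b, c, d] s) (![a, b, c, d] t),
      fun _ => partRel_equivalence.refl _, fun h => partRel_equivalence.symm h,
      fun h h' => partRel_equivalence.trans h h'⟩
  choose w hw0 hw using fun i => sum_restrict_xi (N := N) (by lia) (p i) ![a, b, c, d]
  let V : Fin m → Mat N 0 4 := fun i =>
    Matrix.of fun z _ => if ∀ s t, r i s t → z s = z t then 1 else 0
  have hsum : ∑ i, (α i * w i) • V i ∈ D.C 0 4 := by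
    refine mem_of_entries (fun z y => ?_) (D.comp_mem (restrict_mem hNC he) hD)
    rw [Matrix.mul_apply, Matrix.sum_apply]
    simp only [vecMat, hξ, Finset.sum_apply, Pi.smul_apply, smul_eq_mul, Finset.mul_sum,
      Matrix.of_apply, Matrix.smul_apply]
    rw [Finset.sum_comm]
    refine Finset.sum_congr rfl fun i _ => ?_
    simp only [mul_left_comm _ (α i), ← Finset.mul_sum, hw, mul_assoc]
    refine congrArg _ ?_
    simp only [V, Matrix.of_apply, mul_ite, mul_one, mul_zero]
    exact if_congr Iff.rfl rfl rfl
  have hrest : ∑ i ∈ Finset.univ.erase j, (α i * w i) • V i ∈ D.C 0 4 := by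
    refine Submodule.sum_mem _ fun i hi => Submodule.smul_mem _ _
      (noncrossing_four_mem hNC (r i) fun h h' => ?_)
    by_contra h''
    exact hκ i (Finset.ne_of_mem_erase hi) ⟨a, b, c, d, hab, hbc, hcd, rfl, h, h', h''⟩
  rw [← Finset.add_sum_erase _ _ (Finset.mem_univ j)] at hsum
  have hj := (Submodule.add_mem_iff_left _ hrest).1 hsum
  rw [Submodule.smul_mem_iff _ (mul_ne_zero hα (hw0 j))] at hj
  refine mem_of_entries (fun z y => ?_) hj
  exact if_congr (forall_crossing_four (r j) hac hbd hn z).symm rfl rfl
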